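/- Let m > n and K ≥ 0, suppose (ℝ^n, φ) satisfies the CD(−K, m) condition, and let u : (0,∞) × ℝ^n → ℝ be a smooth positive solution of the heat equation ∂ₜu = Lu. Then for every t > 0 and every x ∈ ℝ^n, |∇u(t,x)|²/u(t,x)² − e^{2Kt} · ∂ₜu(t,x)/u(t,x) ≤ (m/(2t)) e^{4Kt}. (Euclidean case of the paper's Theorem 2.1, the Hamilton differential Harnack inequality for the Witten Laplacian.) -/

import Mathlib

open scoped RealInnerProductSpace

noncomputable section

/-- Hessian of `f` at `x`, evaluated at the pair of vectors `(v, w)`. -/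
def hess (n : ℕ) (f : EuclideanSpace ℝ (Fin n) → ℝ) (x v w : EuclideanSpace ℝ (Fin n)) : ℝ :=
  fderiv ℝ (fun y => fderiv ℝ f y v) x w

/-- Laplacian `Δf = tr ∇²f`. -/
def lap (n : ℕ) (f : EuclideanSpace ℝ (Fin n) → ℝ) (x : EuclideanSpace ℝ (Fin n)) : ℝ :=
  ∑ i : Fin n, hess n f x (EuclideanSpace.single i 1) (EuclideanSpace.single i 1)

/-- Witten Laplacian `Lf = Δf − ⟨∇φ, ∇f⟩`. -/
def witten (n : ℕ) (φ f : EuclideanSpace ℝ (Fin n) → ℝ) (x : EuclideanSpace ℝ (Fin n)) : ℝ :=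
  lap n f x - ⟪gradient φ x, gradient f x⟫

/-- Squared Frobenius norm of the Hessian. -/
def hessNormSq (n : ℕ) (f : EuclideanSpace ℝ (Fin n) → ℝ) (x : EuclideanSpace ℝ (Fin n)) : ℝ :=
  ∑ i : Fin n, ∑ j : Fin n,
    (hess n f x (EuclideanSpace.single i 1) (EuclideanSpace.single j 1)) ^ 2

/-- The `CD(−K, m)` condition on Euclidean space `ℝⁿ`:
`∇²φ(v,v) − ⟨∇φ, v⟩²/(m−n) ≥ −K|v|²` at every point and for every vector. -/
def CDcond (n : ℕ) (φ : EuclideanSpace ℝ (Fin n) → ℝ) (m K : ℝ) : Prop :=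
  ∀ x v : EuclideanSpace ℝ (Fin n),
    hess n φ x v v - ⟪gradient φ x, v⟫ ^ 2 / (m - n) ≥ -K * ‖v‖ ^ 2


/-- Derivative of `f` in the direction `v`, as a function of the base point. -/
def dirDeriv {V : Type*} [NormedAddCommGroup V] [NormedSpace ℝ V] (v : V) (f : V → ℝ) : V → ℝ :=
  fun p => fderiv ℝ f p v

section DirDeriv

variable {V : Type*} [NormedAddCommGroup V] [NormedSpace ℝ V] {U : Set V} {f g : V → ℝ} {p : V}

theorem ContDiffOn.dirDeriv (hU : IsOpen U) (hf : ContDiffOn ℝ (⊤ : ℕ∞) f U) (v : V) :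
    ContDiffOn ℝ (⊤ : ℕ∞) (dirDeriv v f) U :=
  (hf.fderiv_of_isOpen hU (m := (⊤ : ℕ∞)) (by simp)).clm_apply contDiffOn_const

theorem ContDiffOn.differentiableAt_of_isOpen (hU : IsOpen U) (hf : ContDiffOn ℝ (⊤ : ℕ∞) f U)
    (hp : p ∈ U) : DifferentiableAt ℝ f p :=
  (hf.contDiffAt (hU.mem_nhds hp)).differentiableAt (by simp)

theorem dirDeriv_congr (hU : IsOpen U) (h : Set.EqOn f g U) (hp : p ∈ U) (v : V) :
    dirDeriv v f p = dirDeriv v g p := by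
  unfold dirDeriv
  rw [Filter.EventuallyEq.fderiv_eq (h.eventuallyEq_of_mem (hU.mem_nhds hp))]

theorem dirDeriv_comm (hU : IsOpen U) (hf : ContDiffOn ℝ (⊤ : ℕ∞) f U) (hp : p ∈ U) (v w : V) :
    dirDeriv v (dirDeriv w f) p = dirDeriv w (dirDeriv v f) p := by
  have hc := hf.contDiffAt (hU.mem_nhds hp)
  have hd : DifferentiableAt ℝ (fderiv ℝ f) p :=
    ((hf.fderiv_of_isOpen hU (m := (⊤ : ℕ∞)) (by simp)).contDiffAt
      (hU.mem_nhds hp)).differentiableAt (by simp)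
  have hs : IsSymmSndFDerivAt ℝ f p := hc.isSymmSndFDerivAt
    (by simpa using WithTop.coe_le_coe.2 (le_top : (2 : ℕ∞) ≤ ⊤))
  have key : ∀ a b : V, dirDeriv a (dirDeriv b f) p = fderiv ℝ (fderiv ℝ f) p a b := by
    intro a b
    unfold dirDeriv
    rw [fderiv_clm_apply hd (differentiableAt_const _)]
    simp
  rw [key, key]
  exact hs v w

theorem dirDeriv_sub (hf : DifferentiableAt ℝ f p) (hg : DifferentiableAt ℝ g p) (v : V) :
    dirDeriv v (fun x => f x - g x) p = dirDeriv v f p - dirDeriv v g p := by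
  simp [dirDeriv, fderiv_fun_sub hf hg]

theorem dirDeriv_add (hf : DifferentiableAt ℝ f p) (hg : DifferentiableAt ℝ g p) (v : V) :
    dirDeriv v (fun x => f x + g x) p = dirDeriv v f p + dirDeriv v g p := by
  simp [dirDeriv, fderiv_fun_add hf hg]

theorem dirDeriv_mul (hf : DifferentiableAt ℝ f p) (hg : DifferentiableAt ℝ g p) (v : V) :
    dirDeriv v (fun x => f x * g x) p = f p * dirDeriv v g p + g p * dirDeriv v f p := by
  simp [dirDeriv, fderiv_fun_mul hf hg]

theorem dirDeriv_sq (hf : DifferentiableAt ℝ f p) (v : V) :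
    dirDeriv v (fun x => f x ^ 2) p = 2 * f p * dirDeriv v f p := by
  simp only [pow_two]
  rw [dirDeriv_mul hf hf]
  ring

theorem dirDeriv_sum {ι : Type*} {s : Finset ι} {F : ι → V → ℝ}
    (hF : ∀ i ∈ s, DifferentiableAt ℝ (F i) p) (v : V) :
    dirDeriv v (fun x => ∑ i ∈ s, F i x) p = ∑ i ∈ s, dirDeriv v (F i) p := by
  simp [dirDeriv, fderiv_fun_sum hF]

theorem dirDeriv_const (c : ℝ) (v : V) : dirDeriv v (fun _ => c) p = 0 := by
  simp [dirDeriv]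

theorem hasDerivAt_line (hf : DifferentiableAt ℝ f p) (v : V) (s : ℝ) {x : V}
    (hx : x + s • v = p) : HasDerivAt (fun r : ℝ => f (x + r • v)) (dirDeriv v f p) s := by
  subst hx
  have h1 : HasDerivAt (fun r : ℝ => x + r • v) v s := by
    simpa using ((hasDerivAt_id s).smul_const v).const_add x
  exact hf.hasFDerivAt.comp_hasDerivAt s h1

/-- First and second order necessary conditions at a maximum along a line. -/
theorem dirDeriv_of_isLocalMax_line (hU : IsOpen U) (hf : ContDiffOn ℝ (⊤ : ℕ∞) f U) (hp : p ∈ U)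
    (v : V) (hmax : IsLocalMax (fun s : ℝ => f (p + s • v)) 0) :
    dirDeriv v f p = 0 ∧ dirDeriv v (dirDeriv v f) p ≤ 0 := by
  have hnear : ∀ᶠ s : ℝ in nhds 0, p + s • v ∈ U := by
    have hc : ContinuousAt (fun s : ℝ => p + s • v) 0 := by fun_prop
    exact hc.eventually_mem (by simpa using hU.mem_nhds hp)
  have h1 : HasDerivAt (fun s : ℝ => f (p + s • v)) (dirDeriv v f p) 0 :=
    hasDerivAt_line (hf.differentiableAt_of_isOpen hU hp) v 0 (by simp)
  have hev : deriv (fun s : ℝ => f (p + s • v)) =ᶠ[nhds 0] fun s => dirDeriv v f (p + s • v) := by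
    filter_upwards [hnear] with s hs
    exact (hasDerivAt_line (hf.differentiableAt_of_isOpen hU hs) v s rfl).deriv
  have h2 : deriv (deriv fun s : ℝ => f (p + s • v)) 0 = dirDeriv v (dirDeriv v f) p := by
    rw [hev.deriv_eq]
    exact (hasDerivAt_line ((hf.dirDeriv hU v).differentiableAt_of_isOpen hU hp) v 0
      (by simp)).deriv
  have h0 : dirDeriv v f p = 0 := hmax.hasDerivAt_eq_zero h1
  refine ⟨h0, ?_⟩
  by_contra! hlt
  have hmin : IsLocalMin (fun s : ℝ => f (p + s • v)) 0 :=
    isLocalMin_of_deriv_deriv_pos (by rw [h2]; exact hlt) (by rw [h1.deriv, h0])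
      h1.continuousAt
  have hconst : (fun s : ℝ => f (p + s • v)) =ᶠ[nhds 0] fun _ => f (p + (0 : ℝ) • v) := by
    filter_upwards [hmin, hmax] with s hs hs'
    exact le_antisymm hs' hs
  have : deriv (deriv fun s : ℝ => f (p + s • v)) 0 = 0 := by
    rw [hconst.deriv.deriv_eq]
    simp
  rw [h2] at this
  exact hlt.ne' this

/-- First order necessary condition at a maximum along the half-line opposite to `v`. -/
theorem dirDeriv_nonneg_of_max_backward (hf : DifferentiableAt ℝ f p) (v : V)
    (hmax : ∀ᶠ s : ℝ in nhdsWithin 0 (Set.Iic 0), f (p + s • v) ≤ f p) :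
    0 ≤ dirDeriv v f p := by
  have h1 : HasDerivAt (fun s : ℝ => f (p + s • v)) (dirDeriv v f p) 0 :=
    hasDerivAt_line hf v 0 (by simp)
  have h2 := (hasDerivWithinAt_iff_tendsto_slope.1 (h1.hasDerivWithinAt (s := Set.Iic 0)))
  have hsub : Set.Iic (0 : ℝ) \ {0} = Set.Iio 0 := by
    ext s; simp [lt_iff_le_and_ne]
  rw [hsub] at h2
  refine ge_of_tendsto h2 ?_
  have hmax' := hmax.filter_mono (nhdsWithin_mono 0 (Set.Iio_subset_Iic_self (a := (0 : ℝ))))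
  filter_upwards [hmax', self_mem_nhdsWithin] with s hs hs0
  rw [slope_def_field]
  simp only [Set.mem_Iio] at hs0
  apply div_nonneg_of_nonpos
  · simpa using hs
  · linarith

end DirDeriv

section Bochner

variable {V : Type*} [NormedAddCommGroup V] [NormedSpace ℝ V] {U : Set V}

/-- The finite-sum identity behind `bochner_harnack`. -/
theorem bochner_sum_identity {n : ℕ} (a K : ℝ) (F T R ph : Fin n → ℝ) (S Q P : Fin n → Fin n → ℝ)
    (hS : ∀ i j, S i j = S j i)
    (hT : ∀ i, T i = ∑ j, Q i j - ∑ j, (ph j * S i j + F j * P i j) + ∑ j, 2 * F j * S i j) :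
    a * (∑ i, 2 * F i * T i) + (∑ i, F i ^ 2) * (-2 * K * a)
        - (∑ j, R j - ∑ j, ph j * T j + ∑ j, 2 * F j * T j)
      = ∑ j, (a * (∑ i, (2 * F i * Q i j + 2 * S j i * S j i)) - R j)
        - ∑ j, ph j * (a * (∑ i, 2 * F i * S j i) - T j)
        + 2 * ∑ j, F j * (a * (∑ i, 2 * F i * S j i) - T j)
        - 2 * K * a * ∑ i, F i ^ 2 - 2 * a * ∑ i, ∑ j, S i j ^ 2
        - 2 * a * ∑ i, ∑ j, P i j * F i * F j := by
  have h1 : ∑ j, ph j * ∑ i, 2 * F i * S j i = ∑ i, 2 * F i * ∑ j, ph j * S i j := by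
    simp only [Finset.mul_sum]
    rw [Finset.sum_comm]
    refine Finset.sum_congr rfl fun i _ => Finset.sum_congr rfl fun j _ => ?_
    rw [hS j i]
    ring
  have h2 : ∑ j, F j * ∑ i, 2 * F i * S j i = ∑ i, F i * ∑ j, 2 * F j * S i j := rfl
  have h3 : ∑ j, ∑ i, 2 * S j i * S j i = 2 * ∑ i, ∑ j, S i j ^ 2 := by
    simp only [Finset.mul_sum]
    exact Finset.sum_congr rfl fun i _ => Finset.sum_congr rfl fun j _ => by ring
  have h4 : ∑ j, ∑ i, 2 * F i * Q i j = ∑ i, 2 * F i * ∑ j, Q i j := by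
    simp only [Finset.mul_sum]
    rw [Finset.sum_comm]
  have h5 : ∑ i, ∑ j, P i j * F i * F j = ∑ i, F i * ∑ j, F j * P i j := by
    simp only [Finset.mul_sum]
    exact Finset.sum_congr rfl fun i _ => Finset.sum_congr rfl fun j _ => by ring
  have h6 : ∑ i, 2 * F i * T i = ∑ i, 2 * F i * ∑ j, Q i j
      - (∑ i, 2 * F i * ∑ j, ph j * S i j + 2 * ∑ i, F i * ∑ j, F j * P i j)
      + 2 * ∑ i, F i * ∑ j, 2 * F j * S i j := by
    rw [Finset.mul_sum, Finset.mul_sum, ← Finset.sum_add_distrib, ← Finset.sum_sub_distrib,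
      ← Finset.sum_add_distrib]
    refine Finset.sum_congr rfl fun i _ => ?_
    rw [hT i, Finset.sum_add_distrib]
    ring
  have h7 : ∑ j, ph j * (a * (∑ i, 2 * F i * S j i) - T j)
      = a * (∑ j, ph j * ∑ i, 2 * F i * S j i) - ∑ j, ph j * T j := by
    rw [Finset.mul_sum, ← Finset.sum_sub_distrib]
    exact Finset.sum_congr rfl fun j _ => by ring
  have h8 : 2 * ∑ j, F j * (a * (∑ i, 2 * F i * S j i) - T j)
      = 2 * a * (∑ j, F j * ∑ i, 2 * F i * S j i) - ∑ j, 2 * F j * T j := by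
    rw [Finset.mul_sum, Finset.mul_sum, ← Finset.sum_sub_distrib]
    exact Finset.sum_congr rfl fun j _ => by ring
  have h9 : ∑ j, (a * (∑ i, (2 * F i * Q i j + 2 * S j i * S j i)) - R j)
      = a * (∑ j, ∑ i, 2 * F i * Q i j + ∑ j, ∑ i, 2 * S j i * S j i) - ∑ j, R j := by
    rw [← Finset.sum_add_distrib, Finset.mul_sum, ← Finset.sum_sub_distrib]
    exact Finset.sum_congr rfl fun j _ => by rw [Finset.sum_add_distrib]
  rw [h7, h8, h9, h1, h2, h3, h4, h5, h6]
  ring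

/-- Evolution equation of the Hamilton quantity `a |∇f|² - ∂ₜ f` for a solution of
`∂ₜ f = L f + |∇f|²`. -/
theorem bochner_harnack {n : ℕ} (hU : IsOpen U) (e : Fin n → V) (τ : V) (K : ℝ)
    {f φ a H : V → ℝ} (hf : ContDiffOn ℝ (⊤ : ℕ∞) f U) (hφ : ContDiffOn ℝ (⊤ : ℕ∞) φ U)
    (ha : ContDiffOn ℝ (⊤ : ℕ∞) a U) (hae : ∀ i, ∀ p ∈ U, dirDeriv (e i) a p = 0)
    (haτ : ∀ p ∈ U, dirDeriv τ a p = -2 * K * a p)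
    (hφτ : ∀ p ∈ U, dirDeriv τ φ p = 0)
    (hpde : ∀ p ∈ U, dirDeriv τ f p = ∑ i, dirDeriv (e i) (dirDeriv (e i) f) p
      - ∑ i, dirDeriv (e i) φ p * dirDeriv (e i) f p + ∑ i, dirDeriv (e i) f p ^ 2)
    (hH : H = fun p => a p * (∑ i, dirDeriv (e i) f p ^ 2) - dirDeriv τ f p) :
    ∀ p ∈ U, dirDeriv τ H p = ∑ j, dirDeriv (e j) (dirDeriv (e j) H) p
      - ∑ j, dirDeriv (e j) φ p * dirDeriv (e j) H p
      + 2 * ∑ j, dirDeriv (e j) f p * dirDeriv (e j) H p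
      - 2 * K * a p * ∑ i, dirDeriv (e i) f p ^ 2
      - 2 * a p * ∑ i, ∑ j, dirDeriv (e i) (dirDeriv (e j) f) p ^ 2
      - 2 * a p * ∑ i, ∑ j, dirDeriv (e i) (dirDeriv (e j) φ) p
          * dirDeriv (e i) f p * dirDeriv (e j) f p := by
  have hfv := fun v => hf.dirDeriv hU v
  have hfvw := fun v w => (hfv v).dirDeriv hU w
  have hφv := fun v => hφ.dirDeriv hU v
  have dd : ∀ {g : V → ℝ}, ContDiffOn ℝ (⊤ : ℕ∞) g U → ∀ {p}, p ∈ U → DifferentiableAt ℝ g p :=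
    fun hg _ hp => hg.differentiableAt_of_isOpen hU hp
  have hsum : ContDiffOn ℝ (⊤ : ℕ∞) (fun p => ∑ i, dirDeriv (e i) f p ^ 2) U :=
    ContDiffOn.sum fun i _ => (hfv (e i)).pow 2
  have hDsum : ∀ v, ∀ p ∈ U, dirDeriv v (fun p => ∑ i, dirDeriv (e i) f p ^ 2) p
      = ∑ i, 2 * dirDeriv (e i) f p * dirDeriv v (dirDeriv (e i) f) p := by
    intro v p hp
    rw [dirDeriv_sum fun i _ => dd ((hfv (e i)).pow 2) hp]
    exact Finset.sum_congr rfl fun i _ => dirDeriv_sq (dd (hfv _) hp) v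
  have hDH : ∀ v, ∀ p ∈ U, dirDeriv v H p
      = a p * (∑ i, 2 * dirDeriv (e i) f p * dirDeriv v (dirDeriv (e i) f) p)
        + (∑ i, dirDeriv (e i) f p ^ 2) * dirDeriv v a p - dirDeriv v (dirDeriv τ f) p := by
    intro v p hp
    rw [hH, dirDeriv_sub (dd (ha.mul hsum) hp) (dd (hfv τ) hp), dirDeriv_mul (dd ha hp)
      (dd hsum hp), hDsum v p hp]
  have hDeH : ∀ j, ∀ p ∈ U, dirDeriv (e j) H p
      = a p * (∑ i, 2 * dirDeriv (e i) f p * dirDeriv (e j) (dirDeriv (e i) f) p)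
        - dirDeriv (e j) (dirDeriv τ f) p := by
    intro j p hp
    rw [hDH _ p hp, hae j p hp]
    ring
  have hterm : ∀ j i, ContDiffOn ℝ (⊤ : ℕ∞)
      (fun p => 2 * dirDeriv (e i) f p * dirDeriv (e j) (dirDeriv (e i) f) p) U :=
    fun j i => (contDiffOn_const.mul (hfv _)).mul (hfvw _ _)
  have hDDH : ∀ j, ∀ p ∈ U, dirDeriv (e j) (dirDeriv (e j) H) p
      = a p * (∑ i, (2 * dirDeriv (e i) f p * dirDeriv (e j) (dirDeriv (e j) (dirDeriv (e i) f)) p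
          + 2 * dirDeriv (e j) (dirDeriv (e i) f) p * dirDeriv (e j) (dirDeriv (e i) f) p))
        - dirDeriv (e j) (dirDeriv (e j) (dirDeriv τ f)) p := by
    intro j p hp
    have hS : ContDiffOn ℝ (⊤ : ℕ∞) (fun p => ∑ i, 2 * dirDeriv (e i) f p
        * dirDeriv (e j) (dirDeriv (e i) f) p) U := ContDiffOn.sum fun i _ => hterm j i
    rw [dirDeriv_congr hU (fun q hq => hDeH j q hq) hp, dirDeriv_sub (dd (ha.mul hS) hp)
      (dd (hfvw _ _) hp), dirDeriv_mul (dd ha hp) (dd hS hp), hae j p hp, mul_zero, add_zero,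
      dirDeriv_sum fun i _ => dd (hterm j i) hp]
    congr 2
    refine Finset.sum_congr rfl fun i _ => ?_
    rw [dirDeriv_mul (dd (contDiffOn_const.mul (hfv _)) hp) (dd (hfvw _ _) hp),
      dirDeriv_mul (differentiableAt_const _) (dd (hfv _) hp), dirDeriv_const]
    ring
  have hDpde : ∀ v, ∀ p ∈ U, dirDeriv v (dirDeriv τ f) p
      = ∑ j, dirDeriv v (dirDeriv (e j) (dirDeriv (e j) f)) p
        - ∑ j, (dirDeriv (e j) φ p * dirDeriv v (dirDeriv (e j) f) p
          + dirDeriv (e j) f p * dirDeriv v (dirDeriv (e j) φ) p)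
        + ∑ j, 2 * dirDeriv (e j) f p * dirDeriv v (dirDeriv (e j) f) p := by
    intro v p hp
    have h1 : ContDiffOn ℝ (⊤ : ℕ∞) (fun p => ∑ i, dirDeriv (e i) (dirDeriv (e i) f) p) U :=
      ContDiffOn.sum fun i _ => hfvw _ _
    have h2 : ContDiffOn ℝ (⊤ : ℕ∞) (fun p => ∑ i, dirDeriv (e i) φ p * dirDeriv (e i) f p) U :=
      ContDiffOn.sum fun i _ => (hφv _).mul (hfv _)
    rw [dirDeriv_congr hU (fun q hq => hpde q hq) hp, dirDeriv_add (dd (h1.sub h2) hp)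
      (dd hsum hp), dirDeriv_sub (dd h1 hp) (dd h2 hp), hDsum v p hp,
      dirDeriv_sum fun i _ => dd (hfvw _ _) hp,
      dirDeriv_sum fun i _ => dd ((hφv _).mul (hfv _)) hp]
    congr 2
    exact Finset.sum_congr rfl fun i _ => dirDeriv_mul (dd (hφv _) hp) (dd (hfv _) hp) v
  have comm2 : ∀ v j, ∀ p ∈ U, dirDeriv v (dirDeriv (e j) (dirDeriv (e j) f)) p
      = dirDeriv (e j) (dirDeriv (e j) (dirDeriv v f)) p := by
    intro v j p hp
    rw [dirDeriv_comm hU (hfv _) hp]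
    exact dirDeriv_congr hU (fun q hq => dirDeriv_comm hU hf hq _ _) hp _
  intro p hp
  have hφτj : ∀ j, dirDeriv τ (dirDeriv (e j) φ) p = 0 := by
    intro j
    rw [dirDeriv_comm hU hφ hp, dirDeriv_congr hU (g := fun _ => 0) (fun q hq => hφτ q hq) hp,
      dirDeriv_const]
  have hττ := hDpde τ p hp
  simp only [hφτj, mul_zero, add_zero, comm2 τ _ p hp] at hττ
  have hTi : ∀ i, dirDeriv τ (dirDeriv (e i) f) p = dirDeriv (e i) (dirDeriv τ f) p :=
    fun i => dirDeriv_comm hU hf hp _ _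
  have hei := fun i => hDpde (e i) p hp
  simp only [comm2 _ _ p hp] at hei
  simp only [hTi] at hττ
  rw [hDH τ p hp, hττ, haτ p hp]
  simp only [hDeH _ p hp, hDDH _ p hp, hTi]
  exact bochner_sum_identity (a p) K (fun i => dirDeriv (e i) f p)
    (fun i => dirDeriv (e i) (dirDeriv τ f) p)
    (fun j => dirDeriv (e j) (dirDeriv (e j) (dirDeriv τ f)) p)
    (fun i => dirDeriv (e i) φ p) (fun i j => dirDeriv (e i) (dirDeriv (e j) f) p)
    (fun i j => dirDeriv (e j) (dirDeriv (e j) (dirDeriv (e i) f)) p)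
    (fun i j => dirDeriv (e i) (dirDeriv (e j) φ) p)
    (fun i j => dirDeriv_comm hU hf hp _ _) hei

end Bochner

section Barrier

/-- The algebraic contradiction at an interior maximum of the difference with the barrier. -/
theorem barrier_algebra {n : ℕ} {c β C R w θ X g h Sb Sf lam : ℝ} (hc : 0 < c) (hβ : 0 < β)
    (hC : 0 ≤ C) (hR : 1 ≤ R) (hw : 0 < w) (hwR : 1 ≤ w * R ^ 2) (hθ : 0 < θ) (hX : 0 ≤ X)
    (hXR : X ≤ R ^ 2) (hg : 0 ≤ g) (hSf : Sf ^ 2 ≤ g * X) (hSb : -Sb ≤ C * R)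
    (hlam : lam = (4 * n + 24 + 4 * C + 8 / (c * β)) / c * R ^ 3)
    (hh : c⁻¹ * θ + lam * w ^ 2 < h) :
    lam * (4 * n * w ^ 3 + 24 * X * w ^ 4) - 4 * lam * w ^ 3 * Sb + 8 * lam * w ^ 3 * Sf
      - c * (h + β * g) ^ 2 < -(c⁻¹ * θ ^ 2) := by
  have hcβ : 0 < c * β := mul_pos hc hβ
  have hlam0 : 0 < lam := by rw [hlam]; positivity
  have hR2 : 0 < R ^ 2 := by positivity
  have hR23 : R ^ 2 ≤ R ^ 3 := pow_le_pow_right₀ hR (by norm_num)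
  have hw34 : w ^ 3 ≤ w ^ 4 * R ^ 2 := by
    have := mul_le_mul_of_nonneg_left hwR (by positivity : 0 ≤ w ^ 3)
    linarith [this, (by ring : w ^ 3 * (w * R ^ 2) = w ^ 4 * R ^ 2)]
  have k1 : lam * (4 * n * w ^ 3) ≤ lam * w ^ 4 * R ^ 3 * (4 * n) := by
    have : w ^ 3 ≤ w ^ 4 * R ^ 3 := hw34.trans (by gcongr)
    have h4 : (0 : ℝ) ≤ lam * (4 * n) := by positivity
    nlinarith [mul_le_mul_of_nonneg_left this h4]
  have k2 : lam * (24 * X * w ^ 4) ≤ lam * w ^ 4 * R ^ 3 * 24 := by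
    have h4 : (0 : ℝ) ≤ lam * w ^ 4 * 24 := by positivity
    nlinarith [mul_le_mul_of_nonneg_left (hXR.trans hR23) h4]
  have k3 : -(4 * lam * w ^ 3 * Sb) ≤ lam * w ^ 4 * R ^ 3 * (4 * C) := by
    have h4 : (0 : ℝ) ≤ 4 * lam * w ^ 3 := by positivity
    have h5 : (0 : ℝ) ≤ 4 * lam * (C * R) := by positivity
    have h6 := mul_le_mul_of_nonneg_left hSb h4
    have h7 := mul_le_mul_of_nonneg_left hw34 h5
    calc -(4 * lam * w ^ 3 * Sb) = 4 * lam * w ^ 3 * (-Sb) := by ring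
      _ ≤ 4 * lam * w ^ 3 * (C * R) := h6
      _ = 4 * lam * (C * R) * w ^ 3 := by ring
      _ ≤ 4 * lam * (C * R) * (w ^ 4 * R ^ 2) := h7
      _ = _ := by ring
  have k4 : 4 * (w * Sf) ≤ c * β * g + 4 * (w ^ 2 * X) / (c * β) := by
    refine le_of_sq_le_sq ?_ (by positivity)
    have e1 : (c * β * g + 4 * (w ^ 2 * X) / (c * β)) ^ 2
        = (c * β * g - 4 * (w ^ 2 * X) / (c * β)) ^ 2 + 16 * (w ^ 2 * (g * X)) := by
      field_simp; ring
    rw [e1]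
    nlinarith [sq_nonneg (c * β * g - 4 * (w ^ 2 * X) / (c * β)),
      mul_le_mul_of_nonneg_left hSf (sq_nonneg w)]
  have k5 : 8 * lam * w ^ 3 * Sf
      ≤ 2 * c * β * lam * w ^ 2 * g + lam * w ^ 4 * R ^ 3 * (8 / (c * β)) := by
    have h4 : (0 : ℝ) ≤ 2 * lam * w ^ 2 := by positivity
    have h5 : (0 : ℝ) ≤ lam * w ^ 4 * (8 / (c * β)) := by positivity
    calc 8 * lam * w ^ 3 * Sf = 2 * lam * w ^ 2 * (4 * (w * Sf)) := by ring
      _ ≤ 2 * lam * w ^ 2 * (c * β * g + 4 * (w ^ 2 * X) / (c * β)) :=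
        mul_le_mul_of_nonneg_left k4 h4
      _ = 2 * c * β * lam * w ^ 2 * g + lam * w ^ 4 * (8 / (c * β)) * X := by ring
      _ ≤ 2 * c * β * lam * w ^ 2 * g + lam * w ^ 4 * (8 / (c * β)) * R ^ 3 := by
        gcongr; exact hXR.trans hR23
      _ = _ := by ring
  have hY : 0 < c⁻¹ * θ + lam * w ^ 2 := by positivity
  have k6 : c⁻¹ * θ ^ 2 + 2 * θ * lam * w ^ 2 + c * lam ^ 2 * w ^ 4 + 2 * c * β * lam * w ^ 2 * g
      ≤ c * (h + β * g) ^ 2 := by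
    have e : c * (c⁻¹ * θ + lam * w ^ 2 + β * g) ^ 2
        = c⁻¹ * θ ^ 2 + 2 * θ * lam * w ^ 2 + c * lam ^ 2 * w ^ 4 + 2 * c * β * lam * w ^ 2 * g
          + (2 * β * θ * g + c * (β * g) ^ 2) := by
      field_simp; ring
    have h1 : c * (c⁻¹ * θ + lam * w ^ 2 + β * g) ^ 2 ≤ c * (h + β * g) ^ 2 := by gcongr
    have h2 : 0 ≤ 2 * β * θ * g + c * (β * g) ^ 2 := by positivity
    linarith
  have k7 : c * lam ^ 2 * w ^ 4
      = lam * w ^ 4 * R ^ 3 * (4 * n) + lam * w ^ 4 * R ^ 3 * 24 + lam * w ^ 4 * R ^ 3 * (4 * C)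
        + lam * w ^ 4 * R ^ 3 * (8 / (c * β)) := by
    have : c * lam = (4 * n + 24 + 4 * C + 8 / (c * β)) * R ^ 3 := by
      rw [hlam]; field_simp
    calc c * lam ^ 2 * w ^ 4 = lam * w ^ 4 * (c * lam) := by ring
      _ = _ := by rw [this]; ring
  have k8 : 0 < 2 * θ * lam * w ^ 2 := by positivity
  linarith

variable {n : ℕ}

/-- The barrier function `1 / (c (t - ε)) + lam / (R² - |x|²)²`. -/
def barrier (n : ℕ) (c ε lam R : ℝ) (p : ℝ × EuclideanSpace ℝ (Fin n)) : ℝ :=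
  c⁻¹ * (p.1 - ε)⁻¹ + lam * ((R ^ 2 - ∑ i, p.2 i ^ 2)⁻¹) ^ 2

/-- The `i`-th spatial direction of `ℝ × ℝⁿ`. -/
def spaceDir (n : ℕ) (i : Fin n) : ℝ × EuclideanSpace ℝ (Fin n) := (0, EuclideanSpace.single i 1)

/-- The time direction of `ℝ × ℝⁿ`. -/
def timeDir (n : ℕ) : ℝ × EuclideanSpace ℝ (Fin n) := (1, 0)

theorem contDiff_coord (i : Fin n) :
    ContDiff ℝ (⊤ : ℕ∞) fun p : ℝ × EuclideanSpace ℝ (Fin n) => p.2 i := by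
  fun_prop

theorem dirDeriv_coord (i : Fin n) (v p : ℝ × EuclideanSpace ℝ (Fin n)) :
    dirDeriv v (fun p => p.2 i) p = v.2 i := by
  have : (fun p : ℝ × EuclideanSpace ℝ (Fin n) => p.2 i)
      = ((EuclideanSpace.proj i : EuclideanSpace ℝ (Fin n) →L[ℝ] ℝ).comp
        (ContinuousLinearMap.snd ℝ ℝ (EuclideanSpace ℝ (Fin n)))) := by
    ext p; simp
  unfold dirDeriv
  rw [this, ContinuousLinearMap.fderiv]
  simp

theorem dirDeriv_inv {V : Type*} [NormedAddCommGroup V] [NormedSpace ℝ V] {f : V → ℝ} {p : V}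
    (hf : DifferentiableAt ℝ f p) (h0 : f p ≠ 0) (v : V) :
    dirDeriv v (fun x => (f x)⁻¹) p = -((f p)⁻¹ ^ 2 * dirDeriv v f p) := by
  have h : HasFDerivAt (fun x => (f x)⁻¹) (-(f p ^ 2)⁻¹ • fderiv ℝ f p) p :=
    (hasDerivAt_inv h0).comp_hasFDerivAt p hf.hasFDerivAt
  unfold dirDeriv
  rw [h.fderiv]
  simp

/-- Domain of the barrier. -/
def barrierDomain (n : ℕ) (ε R : ℝ) : Set (ℝ × EuclideanSpace ℝ (Fin n)) :=
  {p | ε < p.1 ∧ 0 < R ^ 2 - ∑ i, p.2 i ^ 2}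

theorem isOpen_barrierDomain (ε R : ℝ) : IsOpen (barrierDomain n ε R) := by
  apply IsOpen.and
  · exact isOpen_lt continuous_const continuous_fst
  · exact isOpen_lt continuous_const (by fun_prop)

variable {c ε lam R : ℝ}

theorem contDiff_gap : ContDiff ℝ (⊤ : ℕ∞)
    fun p : ℝ × EuclideanSpace ℝ (Fin n) => R ^ 2 - ∑ i, p.2 i ^ 2 :=
  contDiff_const.sub (ContDiff.sum fun i _ => (contDiff_coord i).pow 2)

theorem contDiffOn_gap_inv : ContDiffOn ℝ (⊤ : ℕ∞)
    (fun p : ℝ × EuclideanSpace ℝ (Fin n) => (R ^ 2 - ∑ i, p.2 i ^ 2)⁻¹)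
    (barrierDomain n ε R) :=
  contDiff_gap.contDiffOn.inv fun _ hp => hp.2.ne'

theorem contDiffOn_time_inv : ContDiffOn ℝ (⊤ : ℕ∞)
    (fun p : ℝ × EuclideanSpace ℝ (Fin n) => (p.1 - ε)⁻¹) (barrierDomain n ε R) :=
  (contDiff_fst.sub contDiff_const).contDiffOn.inv fun _ hp => (sub_pos.2 hp.1).ne'

theorem contDiffOn_barrier :
    ContDiffOn ℝ (⊤ : ℕ∞) (barrier n c ε lam R) (barrierDomain n ε R) :=
  (contDiffOn_const.mul contDiffOn_time_inv).add
    (contDiffOn_const.mul (contDiffOn_gap_inv.pow 2))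

theorem dirDeriv_gap_inv {p : ℝ × EuclideanSpace ℝ (Fin n)} (hp : p ∈ barrierDomain n ε R)
    (v : ℝ × EuclideanSpace ℝ (Fin n)) :
    dirDeriv v (fun p => (R ^ 2 - ∑ i, p.2 i ^ 2)⁻¹) p
      = 2 * ((R ^ 2 - ∑ i, p.2 i ^ 2)⁻¹) ^ 2 * ∑ i, p.2 i * v.2 i := by
  have hcoord := fun i => ((contDiff_coord (n := n) i).differentiable (by simp)) p
  rw [dirDeriv_inv (contDiff_gap.differentiable (by simp) p) hp.2.ne',
    dirDeriv_sub (differentiableAt_const _) (by fun_prop), dirDeriv_const,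
    dirDeriv_sum (fun i _ => (hcoord i).fun_pow 2)]
  simp only [dirDeriv_sq (hcoord _), dirDeriv_coord, mul_assoc, ← Finset.mul_sum]
  ring

theorem dirDeriv_time_inv {p : ℝ × EuclideanSpace ℝ (Fin n)} (hp : p ∈ barrierDomain n ε R)
    (v : ℝ × EuclideanSpace ℝ (Fin n)) :
    dirDeriv v (fun p => (p.1 - ε)⁻¹) p = -((p.1 - ε)⁻¹ ^ 2 * v.1) := by
  rw [dirDeriv_inv (f := fun p : ℝ × EuclideanSpace ℝ (Fin n) => p.1 - ε) (by fun_prop)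
      (sub_pos.2 hp.1).ne',
    dirDeriv_sub (by fun_prop) (by fun_prop), dirDeriv_const]
  simp [dirDeriv, fderiv_fst]

theorem dirDeriv_barrier {p : ℝ × EuclideanSpace ℝ (Fin n)} (hp : p ∈ barrierDomain n ε R)
    (v : ℝ × EuclideanSpace ℝ (Fin n)) :
    dirDeriv v (barrier n c ε lam R) p = -(c⁻¹ * (p.1 - ε)⁻¹ ^ 2 * v.1)
      + 4 * lam * ((R ^ 2 - ∑ i, p.2 i ^ 2)⁻¹) ^ 3 * ∑ i, p.2 i * v.2 i := by
  have hU := isOpen_barrierDomain (n := n) ε R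
  have h1 := contDiffOn_time_inv.differentiableAt_of_isOpen hU hp
  have h2 := contDiffOn_gap_inv.differentiableAt_of_isOpen hU hp
  unfold barrier
  rw [dirDeriv_add ((differentiableAt_const _).fun_mul h1)
    ((differentiableAt_const _).fun_mul (h2.fun_pow 2)), dirDeriv_mul (differentiableAt_const _) h1,
    dirDeriv_mul (differentiableAt_const _) (h2.fun_pow 2), dirDeriv_const, dirDeriv_const,
    dirDeriv_sq h2, dirDeriv_gap_inv hp, dirDeriv_time_inv hp]
  ring

theorem dirDeriv_barrier_time {p : ℝ × EuclideanSpace ℝ (Fin n)} (hp : p ∈ barrierDomain n ε R) :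
    dirDeriv (timeDir n) (barrier n c ε lam R) p = -(c⁻¹ * (p.1 - ε)⁻¹ ^ 2) := by
  rw [dirDeriv_barrier hp]
  simp [timeDir]

theorem dirDeriv_barrier_space {p : ℝ × EuclideanSpace ℝ (Fin n)}
    (hp : p ∈ barrierDomain n ε R) (j : Fin n) :
    dirDeriv (spaceDir n j) (barrier n c ε lam R) p
      = 4 * lam * ((R ^ 2 - ∑ i, p.2 i ^ 2)⁻¹) ^ 3 * p.2 j := by
  rw [dirDeriv_barrier hp]
  simp [spaceDir, PiLp.single_apply]

theorem dirDeriv_dirDeriv_barrier_space {p : ℝ × EuclideanSpace ℝ (Fin n)}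
    (hp : p ∈ barrierDomain n ε R) (j : Fin n) :
    dirDeriv (spaceDir n j) (dirDeriv (spaceDir n j) (barrier n c ε lam R)) p
      = lam * (4 * ((R ^ 2 - ∑ i, p.2 i ^ 2)⁻¹) ^ 3
        + 24 * p.2 j ^ 2 * ((R ^ 2 - ∑ i, p.2 i ^ 2)⁻¹) ^ 4) := by
  have hU := isOpen_barrierDomain (n := n) ε R
  have h2 := contDiffOn_gap_inv.differentiableAt_of_isOpen hU hp
  have hj := ((contDiff_coord (n := n) j).differentiable (by simp)) p
  have e : Set.EqOn (dirDeriv (spaceDir n j) (barrier n c ε lam R))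
      (fun p => 4 * lam * (((R ^ 2 - ∑ i, p.2 i ^ 2)⁻¹ * ((R ^ 2 - ∑ i, p.2 i ^ 2)⁻¹) ^ 2)
        * p.2 j)) (barrierDomain n ε R) := by
    intro q hq
    simp only
    rw [dirDeriv_barrier_space hq]
    ring
  have hs : dirDeriv (spaceDir n j) (fun p => (R ^ 2 - ∑ i, p.2 i ^ 2)⁻¹) p
      = 2 * ((R ^ 2 - ∑ i, p.2 i ^ 2)⁻¹) ^ 2 * p.2 j := by
    rw [dirDeriv_gap_inv hp]
    simp [spaceDir, PiLp.single_apply]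
  rw [dirDeriv_congr hU e hp, dirDeriv_mul (differentiableAt_const _) ((h2.fun_mul (h2.fun_pow 2)).fun_mul hj),
    dirDeriv_mul (h2.fun_mul (h2.fun_pow 2)) hj, dirDeriv_mul h2 (h2.fun_pow 2), dirDeriv_sq h2, hs,
    dirDeriv_coord, dirDeriv_const, show (spaceDir n j).2 j = 1 by simp [spaceDir]]
  ring

end Barrier

section MaximumPrinciple

variable {n : ℕ}

theorem gap_eq (R : ℝ) (x : EuclideanSpace ℝ (Fin n)) :
    R ^ 2 - ∑ i, x i ^ 2 = R ^ 2 - ‖x‖ ^ 2 := by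
  rw [EuclideanSpace.real_norm_sq_eq]

/-- Parabolic maximum principle against the barrier. -/
theorem le_barrier {c β C ε T R : ℝ} (hc : 0 < c) (hβ : 0 < β) (hC : 0 ≤ C) (hε : 0 < ε)
    (hεT : ε < T) (hR : 1 ≤ R) {H : ℝ × EuclideanSpace ℝ (Fin n) → ℝ}
    {b F : Fin n → ℝ × EuclideanSpace ℝ (Fin n) → ℝ}
    (hH : ContDiffOn ℝ (⊤ : ℕ∞) H {p | 0 < p.1})
    (hb : ∀ p, -∑ j, b j p * p.2 j ≤ C * ‖p.2‖)
    (hineq : ∀ p, ε ≤ p.1 → p.1 ≤ T → 0 < H p →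
      dirDeriv (timeDir n) H p ≤ ∑ j, dirDeriv (spaceDir n j) (dirDeriv (spaceDir n j) H) p
        - ∑ j, b j p * dirDeriv (spaceDir n j) H p
        + 2 * ∑ j, F j p * dirDeriv (spaceDir n j) H p - c * (H p + β * ∑ j, F j p ^ 2) ^ 2)
    {x : EuclideanSpace ℝ (Fin n)} (hx : ‖x‖ < R) :
    H (T, x) ≤
      barrier n c ε ((4 * n + 24 + 4 * C + 8 / (c * β)) / c * R ^ 3) R (T, x) := by
  set lam : ℝ := (4 * n + 24 + 4 * C + 8 / (c * β)) / c * R ^ 3 with hlam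
  have hlam0 : 0 < lam := by rw [hlam]; positivity
  by_contra! hlt
  have hR0 : 0 < R := by linarith
  have hUo : IsOpen {p : ℝ × EuclideanSpace ℝ (Fin n) | 0 < p.1} :=
    isOpen_lt continuous_const continuous_fst
  have hDo := isOpen_barrierDomain (n := n) ε R
  have hDU : barrierDomain n ε R ⊆ {p | 0 < p.1} := fun p hp => hε.trans hp.1
  have hball : ∀ p : ℝ × EuclideanSpace ℝ (Fin n), 0 ≤ R ^ 2 - ∑ i, p.2 i ^ 2 → ‖p.2‖ ≤ R := by
    intro p hp
    rw [gap_eq] at hp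
    exact abs_le_of_sq_le_sq' (by linarith) hR0.le |>.2
  have hKc : IsCompact (Set.Icc ε T ×ˢ Metric.closedBall (0 : EuclideanSpace ℝ (Fin n)) R) :=
    isCompact_Icc.prod (isCompact_closedBall _ _)
  obtain ⟨M₀, hM₀⟩ := hKc.exists_bound_of_continuousOn
    (hH.continuousOn.mono fun p hp => hε.trans_le hp.1.1)
  obtain ⟨M, hM, hM0⟩ : ∃ M, M₀ ≤ M ∧ 0 < M :=
    ⟨max M₀ 1, le_max_left _ _, lt_max_of_lt_right one_pos⟩
  set η₁ : ℝ := (c * M)⁻¹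
  set η₂ : ℝ := min 1 (lam / M)
  have hη₁ : 0 < η₁ := by positivity
  have hη₂ : 0 < η₂ := lt_min one_pos (by positivity)
  have hfar : ∀ p ∈ barrierDomain n ε R, p.1 ≤ T → barrier n c ε lam R p < H p →
      η₁ < p.1 - ε ∧ η₂ < R ^ 2 - ∑ i, p.2 i ^ 2 := by
    intro p hp hpT hlt
    have hθ : 0 < p.1 - ε := sub_pos.2 hp.1
    have hq : 0 < R ^ 2 - ∑ i, p.2 i ^ 2 := hp.2
    have hHM : H p ≤ M := (le_abs_self _).trans ((hM₀ p
      ⟨⟨hp.1.le, hpT⟩, by simpa using hball p hq.le⟩).trans hM)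
    unfold barrier at hlt
    constructor
    · have h1 : c⁻¹ * (p.1 - ε)⁻¹ < M := by
        have : 0 < lam * ((R ^ 2 - ∑ i, p.2 i ^ 2)⁻¹) ^ 2 := by positivity
        linarith
      rw [← mul_inv] at h1
      have h2 := inv_lt_of_inv_lt₀ (by positivity) h1
      simp only [η₁]
      rw [inv_lt_iff_one_lt_mul₀ hM0] at h2
      rw [inv_lt_iff_one_lt_mul₀ (by positivity)]
      linarith
    · have h1 : lam * ((R ^ 2 - ∑ i, p.2 i ^ 2)⁻¹) ^ 2 < M := by
        have : 0 < c⁻¹ * (p.1 - ε)⁻¹ := by positivity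
        linarith
      by_contra! hle
      have hle1 : (1 : ℝ) ≤ (R ^ 2 - ∑ i, p.2 i ^ 2)⁻¹ :=
        (one_le_inv₀ hq).2 (hle.trans (min_le_left _ _))
      have hle2 : M / lam ≤ (R ^ 2 - ∑ i, p.2 i ^ 2)⁻¹ := by
        rw [← inv_div]
        exact inv_anti₀ hq (hle.trans (min_le_right _ _))
      have h2 : M / lam ≤ ((R ^ 2 - ∑ i, p.2 i ^ 2)⁻¹) ^ 2 := by nlinarith
      rw [div_le_iff₀ hlam0] at h2
      linarith
  set S : Set (ℝ × EuclideanSpace ℝ (Fin n)) :=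
    {p | η₁ ≤ p.1 - ε ∧ p.1 ≤ T ∧ η₂ ≤ R ^ 2 - ∑ i, p.2 i ^ 2} with hS
  have hSD : S ⊆ barrierDomain n ε R := fun p hp =>
    ⟨by linarith [hp.1], hη₂.trans_le hp.2.2⟩
  have hScl : IsClosed S :=
    (isClosed_le (by fun_prop) (by fun_prop)).and
      ((isClosed_le (by fun_prop) (by fun_prop)).and (isClosed_le (by fun_prop) (by fun_prop)))
  have hSc : IsCompact S := hKc.of_isClosed_subset hScl fun p hp =>
    ⟨⟨(hSD hp).1.le, hp.2.1⟩, by simpa using hball p (hSD hp).2.le⟩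
  have hTx : (T, x) ∈ barrierDomain n ε R := by
    refine ⟨hεT, ?_⟩
    rw [gap_eq]
    nlinarith [norm_nonneg x]
  have hTxS : (T, x) ∈ S := by
    obtain ⟨h1, h2⟩ := hfar _ hTx le_rfl hlt
    exact ⟨h1.le, le_rfl, h2.le⟩
  have hY : ContDiffOn ℝ (⊤ : ℕ∞) (barrier n c ε lam R) (barrierDomain n ε R) :=
    contDiffOn_barrier
  have hΦ : ContDiffOn ℝ (⊤ : ℕ∞) (fun p => H p - barrier n c ε lam R p)
      (barrierDomain n ε R) := (hH.mono hDU).sub hY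
  obtain ⟨p, hpS, hpmax⟩ := hSc.exists_isMaxOn ⟨_, hTxS⟩ (hΦ.continuousOn.mono hSD)
  have hpD := hSD hpS
  have hpY : barrier n c ε lam R p < H p := by
    have := hpmax hTxS
    simp only [Set.mem_ofPred_eq] at this
    linarith
  obtain ⟨hp1, hp2⟩ := hfar p hpD hpS.2.1 hpY
  set W : Set (ℝ × EuclideanSpace ℝ (Fin n)) :=
    {p | η₁ < p.1 - ε ∧ η₂ < R ^ 2 - ∑ i, p.2 i ^ 2}
  have hWo : IsOpen W :=
    (isOpen_lt (by fun_prop) (by fun_prop)).and (isOpen_lt (by fun_prop) (by fun_prop))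
  have hnear : ∀ v : ℝ × EuclideanSpace ℝ (Fin n), ∀ᶠ s : ℝ in nhds 0, p + s • v ∈ W := by
    intro v
    have hc : ContinuousAt (fun s : ℝ => p + s • v) 0 := by fun_prop
    exact hc.eventually_mem (by simpa using hWo.mem_nhds ⟨hp1, hp2⟩)
  have hspace : ∀ j, dirDeriv (spaceDir n j) (fun p => H p - barrier n c ε lam R p) p = 0 ∧
      dirDeriv (spaceDir n j) (dirDeriv (spaceDir n j)
        (fun p => H p - barrier n c ε lam R p)) p ≤ 0 := by
    intro j
    refine dirDeriv_of_isLocalMax_line hDo hΦ hpD _ ?_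
    filter_upwards [hnear (spaceDir n j)] with s hs
    have : p + s • spaceDir n j ∈ S := ⟨hs.1.le, by simpa [spaceDir] using hpS.2.1, hs.2.le⟩
    simpa using hpmax this
  have htime : 0 ≤ dirDeriv (timeDir n) (fun p => H p - barrier n c ε lam R p) p := by
    refine dirDeriv_nonneg_of_max_backward (hΦ.differentiableAt_of_isOpen hDo hpD) _ ?_
    filter_upwards [(hnear (timeDir n)).filter_mono nhdsWithin_le_nhds, self_mem_nhdsWithin]
      with s hs hs0
    have hs0' : s ≤ 0 := hs0
    have : p + s • timeDir n ∈ S :=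
      ⟨hs.1.le, by simp [timeDir]; linarith [hpS.2.1], hs.2.le⟩
    exact hpmax this
  have dH : ∀ q ∈ barrierDomain n ε R, DifferentiableAt ℝ H q := fun q hq =>
    hH.differentiableAt_of_isOpen hUo (hDU hq)
  have dY : ∀ q ∈ barrierDomain n ε R, DifferentiableAt ℝ (barrier n c ε lam R) q := fun q hq =>
    hY.differentiableAt_of_isOpen hDo hq
  have hgrad : ∀ j, dirDeriv (spaceDir n j) H p
      = 4 * lam * ((R ^ 2 - ∑ i, p.2 i ^ 2)⁻¹) ^ 3 * p.2 j := by
    intro j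
    have := (hspace j).1
    rw [dirDeriv_sub (dH p hpD) (dY p hpD), dirDeriv_barrier_space hpD] at this
    linarith
  have hhess : ∀ j, dirDeriv (spaceDir n j) (dirDeriv (spaceDir n j) H) p
      ≤ lam * (4 * ((R ^ 2 - ∑ i, p.2 i ^ 2)⁻¹) ^ 3
        + 24 * p.2 j ^ 2 * ((R ^ 2 - ∑ i, p.2 i ^ 2)⁻¹) ^ 4) := by
    intro j
    have := (hspace j).2
    rw [dirDeriv_congr hDo (fun q hq => dirDeriv_sub (dH q hq) (dY q hq) _) hpD,
      dirDeriv_sub ((hH.dirDeriv hUo _).differentiableAt_of_isOpen hUo (hDU hpD))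
        ((hY.dirDeriv hDo _).differentiableAt_of_isOpen hDo hpD),
      dirDeriv_dirDeriv_barrier_space hpD] at this
    linarith
  rw [dirDeriv_sub (dH p hpD) (dY p hpD), dirDeriv_barrier_time hpD] at htime
  have hq : 0 < R ^ 2 - ∑ i, p.2 i ^ 2 := hpD.2
  have hθ : 0 < p.1 - ε := sub_pos.2 hpD.1
  have hHpos : 0 < H p := by
    refine lt_trans ?_ hpY
    unfold barrier
    positivity
  have hmain := hineq p hpD.1.le hpS.2.1 hHpos
  have hlap := Finset.sum_le_sum fun j (_ : j ∈ Finset.univ) => hhess j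
  set w := (R ^ 2 - ∑ i, p.2 i ^ 2)⁻¹ with hw
  set X := ∑ i, p.2 i ^ 2 with hXdef
  have hX0 : 0 ≤ X := Finset.sum_nonneg fun i _ => sq_nonneg _
  have e1 : ∑ j, lam * (4 * w ^ 3 + 24 * p.2 j ^ 2 * w ^ 4)
      = lam * (4 * n * w ^ 3 + 24 * X * w ^ 4) := by
    have : ∑ j, 24 * p.2 j ^ 2 * w ^ 4 = 24 * X * w ^ 4 := by
      rw [hXdef, Finset.mul_sum, Finset.sum_mul]
    rw [← Finset.mul_sum, Finset.sum_add_distrib, this]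
    simp only [Finset.sum_const, Finset.card_univ, Fintype.card_fin, nsmul_eq_mul]
    ring
  have e2 : ∑ j, b j p * dirDeriv (spaceDir n j) H p
      = 4 * lam * w ^ 3 * ∑ j, b j p * p.2 j := by
    rw [Finset.mul_sum]
    exact Finset.sum_congr rfl fun j _ => by rw [hgrad j]; ring
  have e3 : 2 * ∑ j, F j p * dirDeriv (spaceDir n j) H p
      = 8 * lam * w ^ 3 * ∑ j, F j p * p.2 j := by
    rw [Finset.mul_sum, Finset.mul_sum]
    exact Finset.sum_congr rfl fun j _ => by rw [hgrad j]; ring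
  have hfinal := barrier_algebra (n := n) (c := c) (β := β) (C := C) (R := R) (w := w)
    (θ := (p.1 - ε)⁻¹) (X := X) (g := ∑ j, F j p ^ 2) (h := H p) (Sb := ∑ j, b j p * p.2 j)
    (Sf := ∑ j, F j p * p.2 j) (lam := lam) hc hβ hC hR (inv_pos.2 hq)
    (by rw [hw, inv_mul_eq_div, le_div_iff₀ hq]; linarith) (inv_pos.2 hθ) hX0 (by linarith)
    (Finset.sum_nonneg fun i _ => sq_nonneg _) (Finset.sum_mul_sq_le_sq_mul_sq _ _ _)
    ((hb p).trans (mul_le_mul_of_nonneg_left (hball p hq.le) hC)) hlam hpY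
  linarith

/-- Letting the radius of the barrier tend to infinity. -/
theorem le_of_parabolic_ineq {c β C ε T : ℝ} (hc : 0 < c) (hβ : 0 < β) (hC : 0 ≤ C) (hε : 0 < ε)
    (hεT : ε < T) {H : ℝ × EuclideanSpace ℝ (Fin n) → ℝ}
    {b F : Fin n → ℝ × EuclideanSpace ℝ (Fin n) → ℝ}
    (hH : ContDiffOn ℝ (⊤ : ℕ∞) H {p | 0 < p.1})
    (hb : ∀ p, -∑ j, b j p * p.2 j ≤ C * ‖p.2‖)
    (hineq : ∀ p, ε ≤ p.1 → p.1 ≤ T → 0 < H p →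
      dirDeriv (timeDir n) H p ≤ ∑ j, dirDeriv (spaceDir n j) (dirDeriv (spaceDir n j) H) p
        - ∑ j, b j p * dirDeriv (spaceDir n j) H p
        + 2 * ∑ j, F j p * dirDeriv (spaceDir n j) H p - c * (H p + β * ∑ j, F j p ^ 2) ^ 2)
    (x : EuclideanSpace ℝ (Fin n)) :
    H (T, x) ≤ c⁻¹ * (T - ε)⁻¹ := by
  set D : ℝ := (4 * n + 24 + 4 * C + 8 / (c * β)) / c
  have hD : 0 ≤ D := by positivity
  have hev : ∀ᶠ R : ℝ in Filter.atTop, H (T, x) ≤ c⁻¹ * (T - ε)⁻¹ + 4 * D * R⁻¹ := by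
    filter_upwards [Filter.eventually_ge_atTop 1, Filter.eventually_ge_atTop (2 * ‖x‖ + 1)]
      with R hR1 hRx
    have hx0 := norm_nonneg x
    have h := le_barrier hc hβ hC hε hεT hR1 hH hb hineq (x := x) (by linarith)
    unfold barrier at h
    simp only [gap_eq] at h
    refine h.trans (add_le_add le_rfl ?_)
    have h1 : R ^ 2 / 2 ≤ R ^ 2 - ‖x‖ ^ 2 := by nlinarith
    have h2 : (R ^ 2 - ‖x‖ ^ 2)⁻¹ ≤ (R ^ 2 / 2)⁻¹ := inv_anti₀ (by positivity) h1
    have h3 : 0 ≤ (R ^ 2 - ‖x‖ ^ 2)⁻¹ := inv_nonneg.2 (by nlinarith)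
    calc D * R ^ 3 * (R ^ 2 - ‖x‖ ^ 2)⁻¹ ^ 2 ≤ D * R ^ 3 * (R ^ 2 / 2)⁻¹ ^ 2 := by gcongr
      _ = 4 * D * R⁻¹ := by
        have : R ≠ 0 := by linarith
        field_simp
        norm_num
  have hlim : Filter.Tendsto (fun R : ℝ => c⁻¹ * (T - ε)⁻¹ + 4 * D * R⁻¹) Filter.atTop
      (nhds (c⁻¹ * (T - ε)⁻¹ + 4 * D * 0)) :=
    (tendsto_inv_atTop_zero.const_mul _).const_add _
  simpa using ge_of_tendsto hlim hev

end MaximumPrinciple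

section Witten

variable {n : ℕ}

theorem gradient_apply {f : EuclideanSpace ℝ (Fin n) → ℝ} (x : EuclideanSpace ℝ (Fin n))
    (i : Fin n) : gradient f x i = fderiv ℝ f x (EuclideanSpace.single i 1) := by
  have h : ⟪gradient f x, EuclideanSpace.single i (1 : ℝ)⟫
      = fderiv ℝ f x (EuclideanSpace.single i 1) := InnerProductSpace.toDual_symm_apply
  rw [← h, EuclideanSpace.inner_single_right]
  simp

theorem norm_gradient_sq (f : EuclideanSpace ℝ (Fin n) → ℝ) (x : EuclideanSpace ℝ (Fin n)) :
    ‖gradient f x‖ ^ 2 = ∑ i, fderiv ℝ f x (EuclideanSpace.single i 1) ^ 2 := by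
  rw [EuclideanSpace.real_norm_sq_eq]
  simp only [gradient_apply]

theorem inner_gradient_eq_sum (f g : EuclideanSpace ℝ (Fin n) → ℝ)
    (x : EuclideanSpace ℝ (Fin n)) : ⟪gradient f x, gradient g x⟫
      = ∑ i, fderiv ℝ f x (EuclideanSpace.single i 1)
          * fderiv ℝ g x (EuclideanSpace.single i 1) := by
  rw [PiLp.inner_apply]
  simp [gradient_apply, mul_comm]

theorem eq_sum_single (v : EuclideanSpace ℝ (Fin n)) :
    v = ∑ i, v i • EuclideanSpace.single i (1 : ℝ) := by
  simpa using ((EuclideanSpace.basisFun (Fin n) ℝ).sum_repr v).symm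

theorem hess_eq_fderiv_fderiv {φ : EuclideanSpace ℝ (Fin n) → ℝ}
    (hφ : ContDiff ℝ (⊤ : ℕ∞) φ) (x v w : EuclideanSpace ℝ (Fin n)) :
    hess n φ x v w = fderiv ℝ (fderiv ℝ φ) x w v := by
  have hd : DifferentiableAt ℝ (fderiv ℝ φ) x :=
    (hφ.fderiv_right (m := (⊤ : ℕ∞)) (by simp)).differentiable (by simp) x
  unfold hess
  rw [fderiv_clm_apply hd (differentiableAt_const _)]
  simp

theorem hess_self_eq_sum {φ : EuclideanSpace ℝ (Fin n) → ℝ} (hφ : ContDiff ℝ (⊤ : ℕ∞) φ)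
    (x v : EuclideanSpace ℝ (Fin n)) :
    hess n φ x v v = ∑ i, ∑ j, hess n φ x (EuclideanSpace.single j 1) (EuclideanSpace.single i 1)
      * v i * v j := by
  simp only [hess_eq_fderiv_fderiv hφ]
  conv_lhs => rw [eq_sum_single v]
  simp only [map_sum, map_smul, sum_apply, smul_apply,
    smul_eq_mul, Finset.mul_sum]
  rw [Finset.sum_comm]
  exact Finset.sum_congr rfl fun i _ => Finset.sum_congr rfl fun j _ => by ring

/-- Under `CD(-K, m)` the outward radial derivative of `-φ` grows at most linearly. -/
theorem CDcond.neg_fderiv_self_le {φ : EuclideanSpace ℝ (Fin n) → ℝ} {m K : ℝ}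
    (hφ : ContDiff ℝ (⊤ : ℕ∞) φ) (hm : (n : ℝ) < m) (hCD : CDcond n φ m K)
    (x : EuclideanSpace ℝ (Fin n)) :
    -fderiv ℝ φ x x ≤ (‖fderiv ℝ φ 0‖ + √(K * (m - n)) + 1) * ‖x‖ := by
  set C := ‖fderiv ℝ φ 0‖ + √(K * (m - n)) + 1 with hC
  have hmn : 0 < m - n := sub_pos.2 hm
  rcases eq_or_ne x 0 with rfl | hx
  · simp
  have hx0 : 0 < ‖x‖ := norm_pos_iff.2 hx
  have hsm : ContDiff ℝ (⊤ : ℕ∞) fun y => fderiv ℝ φ y x :=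
    (hφ.fderiv_right (m := (⊤ : ℕ∞)) (by simp)).clm_apply contDiff_const
  have hd : ∀ r : ℝ, HasDerivAt (fun r : ℝ => -fderiv ℝ φ (r • x) x)
      (-hess n φ (r • x) x x) r := by
    intro r
    have := hasDerivAt_line (f := fun y => fderiv ℝ φ y x) (p := r • x) (x := 0)
      (hsm.differentiable (by simp) _) x r (by simp)
    simp only [zero_add] at this
    exact this.neg
  have key := image_le_of_deriv_right_lt_deriv_boundary (a := (0 : ℝ)) (b := 1)
    (f := fun r : ℝ => -fderiv ℝ φ (r • x) x) (f' := fun r => -hess n φ (r • x) x x)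
    (fun r _ => (hd r).continuousAt.continuousWithinAt) (fun r _ => (hd r).hasDerivWithinAt)
    (B := fun _ => C * ‖x‖) (B' := fun _ => 0) ?_ (fun r => hasDerivAt_const r _) ?_
    (Set.right_mem_Icc.2 zero_le_one)
  · simpa using key
  · have h1 : -fderiv ℝ φ 0 x ≤ ‖fderiv ℝ φ 0‖ * ‖x‖ :=
      (neg_le_abs _).trans ((fderiv ℝ φ 0).le_opNorm x)
    have h2 : 0 ≤ √(K * (m - n)) := Real.sqrt_nonneg _
    simp only [zero_smul]
    nlinarith
  · intro r _ hr
    have h := hCD (r • x) x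
    have hin : ⟪gradient φ (r • x), x⟫ = fderiv ℝ φ (r • x) x :=
      InnerProductSpace.toDual_symm_apply
    have hsq : fderiv ℝ φ (r • x) x ^ 2 = (C * ‖x‖) ^ 2 := by rw [← hr]; ring
    rw [hin, hsq] at h
    have hCK : K * (m - n) < C ^ 2 := by
      rcases le_or_gt 0 (K * (m - n)) with h0 | h0
      · have h3 := Real.sq_sqrt h0
        nlinarith [Real.sqrt_nonneg (K * (m - n)), norm_nonneg (fderiv ℝ φ 0)]
      · nlinarith [sq_nonneg C]
    have hKlt : K < C ^ 2 / (m - n) := (lt_div_iff₀ hmn).2 hCK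
    have : (C * ‖x‖) ^ 2 / (m - n) = C ^ 2 / (m - n) * ‖x‖ ^ 2 := by ring
    rw [this] at h
    have := mul_lt_mul_of_pos_right hKlt (by positivity : 0 < ‖x‖ ^ 2)
    linarith

/-- The `CD(-K, m)` condition in the form of the curvature-dimension inequality for `Γ₂`. -/
theorem CDcond.gamma_two_ge {φ : EuclideanSpace ℝ (Fin n) → ℝ} {m K : ℝ} (hn : 1 ≤ n)
    (hφ : ContDiff ℝ (⊤ : ℕ∞) φ) (hm : (n : ℝ) < m) (hCD : CDcond n φ m K)
    (x : EuclideanSpace ℝ (Fin n)) (F : Fin n → ℝ) (S : Fin n → Fin n → ℝ) :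
    (∑ i, S i i - ∑ i, fderiv ℝ φ x (EuclideanSpace.single i 1) * F i) ^ 2 / m
        - K * ∑ i, F i ^ 2
      ≤ ∑ i, ∑ j, S i j ^ 2 + ∑ i, ∑ j, hess n φ x (EuclideanSpace.single j 1)
          (EuclideanSpace.single i 1) * F i * F j := by
  have hmn : 0 < m - n := sub_pos.2 hm
  have hn0 : (0 : ℝ) < n := by exact_mod_cast hn
  have hm0 : 0 < m := hn0.trans hm
  have h := hCD x (WithLp.toLp 2 F)
  have hin : ⟪gradient φ x, WithLp.toLp 2 F⟫
      = ∑ i, fderiv ℝ φ x (EuclideanSpace.single i 1) * F i := by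
    rw [PiLp.inner_apply]
    simp [gradient_apply, mul_comm]
  rw [hess_self_eq_sum hφ, EuclideanSpace.real_norm_sq_eq, hin] at h
  simp only at h
  set p := ∑ i, S i i
  set q := ∑ i, fderiv ℝ φ x (EuclideanSpace.single i 1) * F i
  have h1 : p ^ 2 / n ≤ ∑ i, ∑ j, S i j ^ 2 := by
    have h2 : p ^ 2 ≤ n * ∑ i, S i i ^ 2 := by
      simpa using sq_sum_le_card_mul_sum_sq (s := Finset.univ) (f := fun i => S i i)
    rw [div_le_iff₀ hn0, mul_comm]
    refine h2.trans (mul_le_mul_of_nonneg_left ?_ hn0.le)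
    exact Finset.sum_le_sum fun i _ =>
      Finset.single_le_sum (f := fun j => S i j ^ 2) (fun j _ => sq_nonneg _) (Finset.mem_univ i)
  have h3 : (p - q) ^ 2 / m ≤ p ^ 2 / n + q ^ 2 / (m - n) := by
    rw [div_add_div _ _ hn0.ne' hmn.ne', div_le_div_iff₀ hm0 (by positivity)]
    nlinarith [sq_nonneg (p * (m - n) + q * n)]
  linarith

theorem dirDeriv_comp_snd {g : EuclideanSpace ℝ (Fin n) → ℝ}
    {p : ℝ × EuclideanSpace ℝ (Fin n)} (hg : DifferentiableAt ℝ g p.2)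
    (v : ℝ × EuclideanSpace ℝ (Fin n)) :
    dirDeriv v (fun p => g p.2) p = fderiv ℝ g p.2 v.2 := by
  have h : HasFDerivAt (fun p : ℝ × EuclideanSpace ℝ (Fin n) => g p.2) _ p :=
    hg.hasFDerivAt.comp p hasFDerivAt_snd
  unfold dirDeriv
  rw [h.fderiv]
  simp

theorem fderiv_slice {g : ℝ × EuclideanSpace ℝ (Fin n) → ℝ} {t : ℝ}
    {x : EuclideanSpace ℝ (Fin n)} (hg : DifferentiableAt ℝ g (t, x))
    (v : EuclideanSpace ℝ (Fin n)) :
    fderiv ℝ (fun y => g (t, y)) x v = dirDeriv (0, v) g (t, x) := by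
  have h : HasFDerivAt (fun y => g (t, y)) _ x :=
    HasFDerivAt.comp (g := g) x hg.hasFDerivAt (hasFDerivAt_prodMk_right t x)
  unfold dirDeriv
  rw [h.fderiv]
  simp

theorem deriv_slice {g : ℝ × EuclideanSpace ℝ (Fin n) → ℝ} {t : ℝ}
    {x : EuclideanSpace ℝ (Fin n)} (hg : DifferentiableAt ℝ g (t, x)) :
    deriv (fun s => g (s, x)) t = dirDeriv (timeDir n) g (t, x) := by
  have h := hasDerivAt_line (x := (0, x)) hg (timeDir n) t (by simp [timeDir])
  simpa [timeDir] using h.deriv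

theorem isOpen_posTime : IsOpen {p : ℝ × EuclideanSpace ℝ (Fin n) | 0 < p.1} :=
  isOpen_lt continuous_const continuous_fst

theorem hess_slice {g : ℝ × EuclideanSpace ℝ (Fin n) → ℝ}
    (hg : ContDiffOn ℝ (⊤ : ℕ∞) g {p | 0 < p.1}) {t : ℝ} (ht : 0 < t)
    (x v w : EuclideanSpace ℝ (Fin n)) :
    hess n (fun y => g (t, y)) x v w = dirDeriv (0, w) (dirDeriv (0, v) g) (t, x) := by
  unfold hess
  have : (fun y => fderiv ℝ (fun y => g (t, y)) y v) = fun y => dirDeriv (0, v) g (t, y) := by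
    ext y
    exact fderiv_slice (hg.differentiableAt_of_isOpen isOpen_posTime (p := (t, y)) ht) v
  rw [this]
  exact fderiv_slice ((hg.dirDeriv isOpen_posTime _).differentiableAt_of_isOpen isOpen_posTime
    (p := (t, x)) ht) w

/-- The heat equation in terms of directional derivatives on space-time. -/
theorem witten_slice {φ : EuclideanSpace ℝ (Fin n) → ℝ}
    {g : ℝ × EuclideanSpace ℝ (Fin n) → ℝ} (hg : ContDiffOn ℝ (⊤ : ℕ∞) g {p | 0 < p.1})
    {t : ℝ} (ht : 0 < t) (x : EuclideanSpace ℝ (Fin n)) :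
    witten n φ (fun y => g (t, y)) x
      = ∑ i, dirDeriv (spaceDir n i) (dirDeriv (spaceDir n i) g) (t, x)
        - ∑ i, fderiv ℝ φ x (EuclideanSpace.single i 1) * dirDeriv (spaceDir n i) g (t, x) := by
  unfold witten lap
  rw [inner_gradient_eq_sum]
  simp only [hess_slice hg ht, fderiv_slice
    (hg.differentiableAt_of_isOpen isOpen_posTime (p := (t, x)) ht), spaceDir]

theorem dirDeriv_log {V : Type*} [NormedAddCommGroup V] [NormedSpace ℝ V] {f : V → ℝ} {p : V}
    (hf : DifferentiableAt ℝ f p) (h0 : f p ≠ 0) (v : V) :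
    dirDeriv v (fun x => Real.log (f x)) p = (f p)⁻¹ * dirDeriv v f p := by
  unfold dirDeriv
  rw [(hf.hasFDerivAt.log h0).fderiv]
  simp

theorem dirDeriv_exp_time (K : ℝ) (v p : ℝ × EuclideanSpace ℝ (Fin n)) :
    dirDeriv v (fun p => Real.exp (-(2 * K * p.1))) p
      = -2 * K * Real.exp (-(2 * K * p.1)) * v.1 := by
  have h : HasFDerivAt (fun p : ℝ × EuclideanSpace ℝ (Fin n) => Real.exp (-(2 * K * p.1))) _ p :=
    ((hasFDerivAt_fst (𝕜 := ℝ) (p := p)).const_mul (2 * K)).neg.exp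
  unfold dirDeriv
  rw [h.fderiv]
  simp
  ring

/-- If `g > 0` solves the heat equation, `log g` solves `∂ₜ f = L f + |∇f|²`. -/
theorem log_heat {V : Type*} [NormedAddCommGroup V] [NormedSpace ℝ V] {U : Set V}
    (hU : IsOpen U) {g : V → ℝ} (hg : ContDiffOn ℝ (⊤ : ℕ∞) g U) (hpos : ∀ p ∈ U, 0 < g p)
    (e : Fin n → V) (τ : V) (b : Fin n → V → ℝ)
    (hheat : ∀ p ∈ U, dirDeriv τ g p = ∑ i, dirDeriv (e i) (dirDeriv (e i) g) p
      - ∑ i, b i p * dirDeriv (e i) g p) :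
    ∀ p ∈ U, dirDeriv τ (fun q => Real.log (g q)) p
      = ∑ i, dirDeriv (e i) (dirDeriv (e i) fun q => Real.log (g q)) p
        - ∑ i, b i p * dirDeriv (e i) (fun q => Real.log (g q)) p
        + ∑ i, dirDeriv (e i) (fun q => Real.log (g q)) p ^ 2 := by
  have hd : ∀ q ∈ U, DifferentiableAt ℝ g q := fun q hq => hg.differentiableAt_of_isOpen hU hq
  have h1 : ∀ v, ∀ q ∈ U, dirDeriv v (fun q => Real.log (g q)) q = (g q)⁻¹ * dirDeriv v g q :=
    fun v q hq => dirDeriv_log (hd q hq) (hpos q hq).ne' v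
  have hinv : ContDiffOn ℝ (⊤ : ℕ∞) (fun q => (g q)⁻¹) U := hg.inv fun q hq => (hpos q hq).ne'
  intro p hp
  have h2 : ∀ i, dirDeriv (e i) (dirDeriv (e i) fun q => Real.log (g q)) p
      = (g p)⁻¹ * dirDeriv (e i) (dirDeriv (e i) g) p - ((g p)⁻¹ * dirDeriv (e i) g p) ^ 2 := by
    intro i
    rw [dirDeriv_congr hU (fun q hq => h1 (e i) q hq) hp,
      dirDeriv_mul (hinv.differentiableAt_of_isOpen hU hp)
        ((hg.dirDeriv hU _).differentiableAt_of_isOpen hU hp),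
      dirDeriv_inv (hd p hp) (hpos p hp).ne']
    ring
  simp only [h1 _ p hp, h2]
  rw [hheat p hp, Finset.sum_sub_distrib, ← Finset.mul_sum, sub_add_eq_add_sub,
    sub_add_cancel, mul_sub, Finset.mul_sum (f := fun i => b i p * dirDeriv (e i) g p)]
  congr 1
  exact Finset.sum_congr rfl fun i _ => by ring

/-- Hamilton's Harnack inequality with a strictly positive curvature parameter. -/
theorem harnack_of_pos (hn : 1 ≤ n) {m K : ℝ} (hm : (n : ℝ) < m) (hK : 0 < K)
    {φ : EuclideanSpace ℝ (Fin n) → ℝ} (hφ : ContDiff ℝ (⊤ : ℕ∞) φ) (hCD : CDcond n φ m K)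
    {g : ℝ × EuclideanSpace ℝ (Fin n) → ℝ} (hg : ContDiffOn ℝ (⊤ : ℕ∞) g {p | 0 < p.1})
    (hpos : ∀ p : ℝ × EuclideanSpace ℝ (Fin n), 0 < p.1 → 0 < g p)
    (hheat : ∀ p : ℝ × EuclideanSpace ℝ (Fin n), 0 < p.1 → dirDeriv (timeDir n) g p
      = ∑ i, dirDeriv (spaceDir n i) (dirDeriv (spaceDir n i) g) p
        - ∑ i, fderiv ℝ φ p.2 (EuclideanSpace.single i 1) * dirDeriv (spaceDir n i) g p)
    {T : ℝ} (hT : 0 < T) (x : EuclideanSpace ℝ (Fin n)) :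
    Real.exp (-(2 * K * T)) * (∑ i, ((g (T, x))⁻¹ * dirDeriv (spaceDir n i) g (T, x)) ^ 2)
        - (g (T, x))⁻¹ * dirDeriv (timeDir n) g (T, x)
      ≤ m * Real.exp (2 * K * T) / 2 * T⁻¹ := by
  have hU := isOpen_posTime (n := n)
  have hm0 : 0 < m := lt_of_le_of_lt (Nat.cast_nonneg n) hm
  set f : ℝ × EuclideanSpace ℝ (Fin n) → ℝ := fun p => Real.log (g p) with hf_def
  have hf : ContDiffOn ℝ (⊤ : ℕ∞) f {p | 0 < p.1} := hg.log fun p hp => (hpos p hp).ne'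
  have hφd : Differentiable ℝ φ := hφ.differentiable (by simp)
  have hφ1 : ∀ i, dirDeriv (spaceDir n i) (fun p => φ p.2)
      = fun p => fderiv ℝ φ p.2 (EuclideanSpace.single i 1) :=
    fun i => funext fun p => dirDeriv_comp_snd (hφd _) _
  have hφ2 : ∀ i j p, dirDeriv (spaceDir n i) (dirDeriv (spaceDir n j) fun p => φ p.2) p
      = hess n φ p.2 (EuclideanSpace.single j 1) (EuclideanSpace.single i 1) := by
    intro i j p
    have hs : ContDiff ℝ (⊤ : ℕ∞) fun y => fderiv ℝ φ y (EuclideanSpace.single j 1) :=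
      (hφ.fderiv_right (m := (⊤ : ℕ∞)) (by simp)).clm_apply contDiff_const
    rw [hφ1, dirDeriv_comp_snd (hs.differentiable (by simp) _)]
    rfl
  have hpde := log_heat hU hg hpos (spaceDir n) (timeDir n)
    (fun i p => fderiv ℝ φ p.2 (EuclideanSpace.single i 1)) hheat
  set a : ℝ × EuclideanSpace ℝ (Fin n) → ℝ := fun p => Real.exp (-(2 * K * p.1)) with ha_def
  have ha : ContDiff ℝ (⊤ : ℕ∞) a := (contDiff_const.mul contDiff_fst).neg.exp
  set H : ℝ × EuclideanSpace ℝ (Fin n) → ℝ :=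
    fun p => a p * (∑ i, dirDeriv (spaceDir n i) f p ^ 2) - dirDeriv (timeDir n) f p with hH_def
  have hH : ContDiffOn ℝ (⊤ : ℕ∞) H {p | 0 < p.1} :=
    (ha.contDiffOn.mul (ContDiffOn.sum fun i _ => (hf.dirDeriv hU _).pow 2)).sub
      (hf.dirDeriv hU _)
  have hboch := bochner_harnack hU (spaceDir n) (timeDir n) K hf
    (hφ.comp contDiff_snd).contDiffOn (φ := fun p => φ p.2) ha.contDiffOn
    (fun i p _ => by rw [dirDeriv_exp_time]; simp [spaceDir])
    (fun p _ => by rw [dirDeriv_exp_time]; simp [timeDir, ha_def])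
    (fun p _ => by rw [dirDeriv_comp_snd (hφd _)]; simp [timeDir])
    (by simpa only [hφ1] using hpde) hH_def
  set c : ℝ := 2 / (m * Real.exp (2 * K * T)) with hc_def
  have hc : 0 < c := by positivity
  have hb : ∀ p : ℝ × EuclideanSpace ℝ (Fin n),
      -∑ j, fderiv ℝ φ p.2 (EuclideanSpace.single j 1) * p.2 j
        ≤ (‖fderiv ℝ φ 0‖ + √(K * (m - n)) + 1) * ‖p.2‖ := by
    intro p
    refine le_trans (le_of_eq ?_) (hCD.neg_fderiv_self_le hφ hm p.2)
    congr 1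
    conv_rhs => arg 2; rw [eq_sum_single p.2]
    simp [mul_comm]
  have hε : ∀ ε, 0 < ε → ε < T → H (T, x) ≤ c⁻¹ * (T - ε)⁻¹ := by
    intro ε hε hεT
    have hβ : 0 < 1 - Real.exp (-(2 * K * ε)) := by
      rw [sub_pos, Real.exp_lt_one_iff]
      have : 0 < 2 * K * ε := by positivity
      linarith
    refine le_of_parabolic_ineq (F := fun j p => dirDeriv (spaceDir n j) f p) hc hβ
      (by positivity) hε hεT hH hb ?_ x
    intro p hp1 hp2 hHp
    have hp0 : 0 < p.1 := hε.trans_le hp1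
    have h1 := hboch p hp0
    have h2 := hpde p hp0
    have h3 := hCD.gamma_two_ge hn hφ hm p.2 (fun i => dirDeriv (spaceDir n i) f p)
      (fun i j => dirDeriv (spaceDir n i) (dirDeriv (spaceDir n j) f) p)
    simp only [hφ2] at h1
    simp only [hφ1] at h1
    have hHp' : H p = a p * (∑ i, dirDeriv (spaceDir n i) f p ^ 2) - dirDeriv (timeDir n) f p :=
      rfl
    set G := ∑ i, dirDeriv (spaceDir n i) f p ^ 2
    have hG : 0 ≤ G := Finset.sum_nonneg fun i _ => sq_nonneg _
    set L := ∑ i, dirDeriv (spaceDir n i) (dirDeriv (spaceDir n i) f) p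
      - ∑ i, fderiv ℝ φ p.2 (EuclideanSpace.single i 1) * dirDeriv (spaceDir n i) f p
    have hap : 0 < a p := Real.exp_pos _
    have haβ : a p ≤ Real.exp (-(2 * K * ε)) := by
      refine Real.exp_le_exp.2 (neg_le_neg ?_)
      gcongr
    have haT : (Real.exp (2 * K * T))⁻¹ ≤ a p := by
      rw [← Real.exp_neg]
      refine Real.exp_le_exp.2 (neg_le_neg ?_)
      gcongr
    have hsq : (H p + (1 - Real.exp (-(2 * K * ε))) * G) ^ 2 ≤ L ^ 2 := by
      rw [← neg_sq L]
      refine pow_le_pow_left₀ (by positivity) ?_ 2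
      nlinarith
    have hcm : c = 2 * (Real.exp (2 * K * T))⁻¹ / m := by
      rw [hc_def]; field_simp
    have hcL : c * (H p + (1 - Real.exp (-(2 * K * ε))) * G) ^ 2 ≤ 2 * a p * (L ^ 2 / m) := by
      calc c * (H p + (1 - Real.exp (-(2 * K * ε))) * G) ^ 2 ≤ (2 * a p / m) * L ^ 2 := by
            rw [hcm]; gcongr
        _ = _ := by ring
    have h4 := mul_le_mul_of_nonneg_left h3 (by positivity : 0 ≤ 2 * a p)
    linarith
  have hlim : Filter.Tendsto (fun ε : ℝ => c⁻¹ * (T - ε)⁻¹) (nhdsWithin 0 (Set.Ioi 0))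
      (nhds (c⁻¹ * (T - 0)⁻¹)) := by
    refine Filter.Tendsto.mono_left ?_ nhdsWithin_le_nhds
    refine ContinuousAt.tendsto (f := fun ε : ℝ => c⁻¹ * (T - ε)⁻¹) ?_
    exact continuousAt_const.mul ((continuousAt_const.sub continuousAt_id).inv₀
      (by simpa using hT.ne'))
  have hfin := ge_of_tendsto hlim (by
    filter_upwards [Ioo_mem_nhdsGT hT] with ε h using hε ε h.1 h.2)
  have hgd := hg.differentiableAt_of_isOpen hU (p := (T, x)) hT
  have hg0 := (hpos (T, x) hT).ne'
  simp only [hH_def, hf_def, ha_def, dirDeriv_log hgd hg0, sub_zero, hc_def, inv_div] at hfin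
  exact hfin

end Witten

/-- **Hamilton differential Harnack inequality** for the Witten Laplacian on `ℝⁿ`
under the `CD(−K, m)` condition (Euclidean case of Theorem 2.1). -/
theorem hamilton_harnack_witten
    (n : ℕ) (hn : 1 ≤ n) (m K : ℝ) (hm : (n : ℝ) < m) (hK : 0 ≤ K)
    (φ : EuclideanSpace ℝ (Fin n) → ℝ) (hφ : ContDiff ℝ (⊤ : ℕ∞) φ)
    (hCD : CDcond n φ m K)
    (u : ℝ → EuclideanSpace ℝ (Fin n) → ℝ)
    (hu : ContDiffOn ℝ (⊤ : ℕ∞) (fun p : ℝ × EuclideanSpace ℝ (Fin n) => u p.1 p.2)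
      {p : ℝ × EuclideanSpace ℝ (Fin n) | 0 < p.1})
    (hpos : ∀ t > (0 : ℝ), ∀ x, 0 < u t x)
    (hheat : ∀ t > (0 : ℝ), ∀ x, deriv (fun s => u s x) t = witten n φ (u t) x) :
    ∀ t > (0 : ℝ), ∀ x,
      ‖gradient (u t) x‖ ^ 2 / (u t x) ^ 2
          - Real.exp (2 * K * t) * deriv (fun s => u s x) t / u t x
        ≤ (m / (2 * t)) * Real.exp (4 * K * t) := by
  intro t ht x
  set g : ℝ × EuclideanSpace ℝ (Fin n) → ℝ := fun p => u p.1 p.2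
  have hgd : ∀ t > (0 : ℝ), ∀ x, DifferentiableAt ℝ g (t, x) := fun t ht x =>
    hu.differentiableAt_of_isOpen isOpen_posTime (p := (t, x)) ht
  have hheat' : ∀ p : ℝ × EuclideanSpace ℝ (Fin n), 0 < p.1 → dirDeriv (timeDir n) g p
      = ∑ i, dirDeriv (spaceDir n i) (dirDeriv (spaceDir n i) g) p
        - ∑ i, fderiv ℝ φ p.2 (EuclideanSpace.single i 1) * dirDeriv (spaceDir n i) g p := by
    rintro ⟨s, y⟩ hs
    rw [← deriv_slice (hgd s hs y), ← witten_slice hu hs y]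
    exact hheat s hs y
  have hderiv : deriv (fun s => u s x) t = dirDeriv (timeDir n) g (t, x) :=
    deriv_slice (hgd t ht x)
  have hgrad : ‖gradient (u t) x‖ ^ 2 = ∑ i, dirDeriv (spaceDir n i) g (t, x) ^ 2 := by
    rw [norm_gradient_sq]
    exact Finset.sum_congr rfl fun i _ => by rw [spaceDir, ← fderiv_slice (hgd t ht x)]
  have hut : 0 < u t x := hpos t ht x
  have hbound : ∀ K' > K, ‖gradient (u t) x‖ ^ 2 / (u t x) ^ 2
      - Real.exp (2 * K' * t) * deriv (fun s => u s x) t / u t x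
        ≤ (m / (2 * t)) * Real.exp (4 * K' * t) := by
    intro K' hK'
    have hCD' : CDcond n φ m K' := fun y v => by
      have h1 := hCD y v
      have h2 := mul_le_mul_of_nonneg_right hK'.le (sq_nonneg ‖v‖)
      linarith
    have h := harnack_of_pos hn hm (hK.trans_lt hK') hφ hCD' hu
      (fun p hp => hpos p.1 hp p.2) hheat' ht x
    have hE := mul_le_mul_of_nonneg_left h (Real.exp_pos (2 * K' * t)).le
    rw [hgrad, hderiv]
    have e1 : Real.exp (4 * K' * t) = Real.exp (2 * K' * t) * Real.exp (2 * K' * t) := by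
      rw [← Real.exp_add]; ring_nf
    have e2 : ∑ i, ((g (t, x))⁻¹ * dirDeriv (spaceDir n i) g (t, x)) ^ 2
        = (∑ i, dirDeriv (spaceDir n i) g (t, x) ^ 2) / (u t x) ^ 2 := by
      rw [Finset.sum_div]
      exact Finset.sum_congr rfl fun i _ => by rw [mul_pow, inv_pow, inv_mul_eq_div]
    rw [e2, mul_sub, ← mul_assoc, ← Real.exp_add, add_neg_cancel, Real.exp_zero, one_mul] at hE
    rw [e1]
    refine (le_of_eq ?_).trans (hE.trans (le_of_eq ?_))
    · simp only [g]; ring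
    · field_simp
  have hl : Filter.Tendsto (fun K' : ℝ => ‖gradient (u t) x‖ ^ 2 / (u t x) ^ 2
      - Real.exp (2 * K' * t) * deriv (fun s => u s x) t / u t x) (nhdsWithin K (Set.Ioi K))
      (nhds (‖gradient (u t) x‖ ^ 2 / (u t x) ^ 2
        - Real.exp (2 * K * t) * deriv (fun s => u s x) t / u t x)) :=
    (Continuous.tendsto (by fun_prop) K).mono_left nhdsWithin_le_nhds
  have hr : Filter.Tendsto (fun K' : ℝ => (m / (2 * t)) * Real.exp (4 * K' * t))
      (nhdsWithin K (Set.Ioi K)) (nhds ((m / (2 * t)) * Real.exp (4 * K * t))) :=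
    (Continuous.tendsto (by fun_prop) K).mono_left nhdsWithin_le_nhds
  exact le_of_tendsto_of_tendsto hl hr (by
    filter_upwards [self_mem_nhdsWithin] with K' hK' using hbound K' hK')
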